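/- Let r ≥ 1 and let n_1, …, n_r, m_1, …, m_r be real numbers. Define A : {0, …, r} → ℝ by A 0 = 1 and A k = A (k−1) + n_k · (m_r + 1 + Σ_{i=1}^{k−1} m_i · A i), and B : {0, …, r} → ℝ by B 0 = 0 and B k = B (k−1) + n_k · (1 + Σ_{i=1}^{k−1} m_i · B i). Then for all 1 ≤ k ≤ r: (i) A k = P([m_r + 1, n_1, m_1, n_2, …, m_{k−1}, n_k]); (ii) 1 + m_r + Σ_{i=1}^{k} m_i · A i = P([m_r + 1, n_1, m_1, …, n_k, m_k]); (iii) B k = P([n_1, m_1, n_2, …, m_{k−1}, n_k]); (iv) 1 + Σ_{i=1}^{k} m_i · B i = P([n_1, m_1, …, n_k, m_k]). -/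

import Mathlib

/-- Auxiliary recursion on reversed lists: `contRev (x_k :: [x_{k-1}, …, x_1])` computes the
continuant `P(x_1, …, x_k)`. -/
noncomputable def contRev : List ℝ → ℝ
  | [] => 1
  | [x] => x
  | x :: y :: t => x * contRev (y :: t) + contRev t

/-- The continuant `P` of a list of real numbers: `P [] = 1`, `P [x] = x` and
`P [x_1, …, x_k] = x_k · P [x_1, …, x_{k−1}] + P [x_1, …, x_{k−2}]`. -/
noncomputable def continuant (l : List ℝ) : ℝ := contRev l.reverse

/-- The full alternating list `[n_1, m_1, n_2, m_2, …, n_r, m_r]`. -/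
def altList (nn mm : ℕ → ℝ) (r : ℕ) : List ℝ :=
  (List.range r).flatMap fun i => [nn (i + 1), mm (i + 1)]

theorem continuant_append_pair (l : List ℝ) (x y : ℝ) :
    continuant (l ++ [x, y]) = y * continuant (l ++ [x]) + continuant l := by
  simp [continuant, contRev]

theorem altList_succ (nn mm : ℕ → ℝ) (k : ℕ) :
    altList nn mm (k + 1) = altList nn mm k ++ [nn (k + 1), mm (k + 1)] := by
  simp [altList, List.range_succ]

/-- A sequence with the matching-number recursion and initial data compatible with a list `p`
is given by the continuants of `p` followed by the alternating list. -/
theorem recursion_eq_continuant (p : List ℝ) (r : ℕ) (nn mm C : ℕ → ℝ)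
    (hp : ∀ x, continuant (p ++ [x]) = x * continuant p + C 0)
    (hC : ∀ k : ℕ, 1 ≤ k → k ≤ r →
      C k = C (k - 1) + nn k * (continuant p + ∑ i ∈ Finset.Icc 1 (k - 1), mm i * C i))
    (k : ℕ) (hk : k + 1 ≤ r) :
    C (k + 1) = continuant (p ++ altList nn mm k ++ [nn (k + 1)]) ∧
      continuant p + ∑ i ∈ Finset.Icc 1 (k + 1), mm i * C i
        = continuant (p ++ altList nn mm (k + 1)) := by
  have snd_of_fst (j : ℕ)
      (h₁ : C (j + 1) = continuant (p ++ altList nn mm j ++ [nn (j + 1)]))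
      (h₂ : continuant p + ∑ i ∈ Finset.Icc 1 j, mm i * C i = continuant (p ++ altList nn mm j)) :
      continuant p + ∑ i ∈ Finset.Icc 1 (j + 1), mm i * C i
        = continuant (p ++ altList nn mm (j + 1)) := by
    rw [Finset.sum_Icc_succ_top (by omega), altList_succ, ← List.append_assoc,
      continuant_append_pair, ← h₁, ← h₂]
    ring
  induction k with
  | zero =>
    have h₁ : C (0 + 1) = continuant (p ++ altList nn mm 0 ++ [nn (0 + 1)]) := by
      have h := hC 1 le_rfl hk
      simp only [Nat.sub_self, Finset.Icc_eq_empty_of_lt Nat.zero_lt_one, Finset.sum_empty] at h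
      simp only [altList, List.range_zero, List.flatMap_nil, List.append_nil, hp, zero_add, h]
      ring
    exact ⟨h₁, snd_of_fst 0 h₁ (by simp [altList])⟩
  | succ j ih =>
    obtain ⟨ih₁, ih₂⟩ := ih (by omega)
    have h₁ : C (j + 1 + 1)
        = continuant (p ++ altList nn mm (j + 1) ++ [nn (j + 1 + 1)]) := by
      have hl : p ++ altList nn mm (j + 1) ++ [nn (j + 1 + 1)]
          = (p ++ altList nn mm j ++ [nn (j + 1)]) ++ [mm (j + 1), nn (j + 1 + 1)] := by
        simp [altList_succ]
      have hl' : (p ++ altList nn mm j ++ [nn (j + 1)]) ++ [mm (j + 1)]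
          = p ++ altList nn mm (j + 1) := by
        simp [altList_succ]
      rw [hl, continuant_append_pair, hl', ← ih₁, ← ih₂, hC _ (by omega) hk,
        Nat.add_sub_cancel]
      ring
    exact ⟨h₁, snd_of_fst _ h₁ ih₂⟩

/-- **Lemma (matching numbers as continuants).**
Let `r ≥ 1` and `n_1, …, n_r, m_1, …, m_r` be reals.  Define `A` by `A 0 = 1`,
`A k = A (k−1) + n_k (m_r + 1 + Σ_{i=1}^{k−1} m_i A i)` and `B` by `B 0 = 0`,
`B k = B (k−1) + n_k (1 + Σ_{i=1}^{k−1} m_i B i)` for `1 ≤ k ≤ r`.  Then for `1 ≤ k ≤ r`: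
(i) `A k = P([m_r+1, n_1, m_1, …, m_{k−1}, n_k])`;
(ii) `1 + m_r + Σ_{i=1}^k m_i A i = P([m_r+1, n_1, m_1, …, n_k, m_k])`;
(iii) `B k = P([n_1, m_1, …, m_{k−1}, n_k])`;
(iv) `1 + Σ_{i=1}^k m_i B i = P([n_1, m_1, …, n_k, m_k])`. -/
theorem matching_numbers_as_continuants
    (r : ℕ) (hr : 1 ≤ r) (nn mm : ℕ → ℝ)
    (A B : ℕ → ℝ)
    (hA0 : A 0 = 1)
    (hA : ∀ k : ℕ, 1 ≤ k → k ≤ r →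
      A k = A (k - 1) + nn k * (mm r + 1 + ∑ i ∈ Finset.Icc 1 (k - 1), mm i * A i))
    (hB0 : B 0 = 0)
    (hB : ∀ k : ℕ, 1 ≤ k → k ≤ r →
      B k = B (k - 1) + nn k * (1 + ∑ i ∈ Finset.Icc 1 (k - 1), mm i * B i)) :
    ∀ k : ℕ, 1 ≤ k → k ≤ r →
      A k = continuant ((mm r + 1) :: (altList nn mm (k - 1) ++ [nn k])) ∧
      1 + mm r + ∑ i ∈ Finset.Icc 1 k, mm i * A i
        = continuant ((mm r + 1) :: altList nn mm k) ∧
      B k = continuant (altList nn mm (k - 1) ++ [nn k]) ∧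
      1 + ∑ i ∈ Finset.Icc 1 k, mm i * B i = continuant (altList nn mm k) := by
  intro k hk hkr
  obtain ⟨k, rfl⟩ := Nat.exists_eq_add_of_le' hk
  have hc : continuant [mm r + 1] = mm r + 1 := by simp [continuant, contRev]
  have hn : continuant [] = 1 := by simp [continuant, contRev]
  obtain ⟨hA₁, hA₂⟩ := recursion_eq_continuant [mm r + 1] r nn mm A
    (by simp [continuant, contRev, hA0]) (by simpa only [hc] using hA) k hkr
  obtain ⟨hB₁, hB₂⟩ := recursion_eq_continuant [] r nn mm B
    (by simp [continuant, contRev, hB0]) (by simpa only [hn] using hB) k hkr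
  rw [hc, add_comm (mm r)] at hA₂
  rw [hn] at hB₂
  refine ⟨hA₁, ?_, hB₁, hB₂⟩
  rw [hA₂, add_comm 1 (mm r)]
  rfl
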